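/- Let p be a prime, q = p^n, and let ℓ ≥ 2 and r ≥ 1 be integers such that ℓ/u is even, where u = gcd(ℓ, r). Let a, b, c ∈ F_{q^ℓ} with a ≠ 0 and set f(x) = a^{q^r}·x^{q^{2r}} + a·x. If the equation f(x) = −b^{q^r} has no solution x ∈ F_{q^ℓ}, then N_{ℓ,r}(a,b,c) = q^ℓ. -/

import Mathlib

open Module

section FiniteFieldTrace

variable {K L : Type*} [Field K] [Fintype K] [Field L] [Algebra K L]

theorem frobeniusAlgHom_pow_apply (i : ℕ) (x : L) :
    (FiniteField.frobeniusAlgHom K L ^ i) x = x ^ Fintype.card K ^ i := by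
  rw [AlgHom.coe_pow, FiniteField.coe_frobeniusAlgHom, pow_iterate]

variable [Finite L]

theorem trace_pow_card_pow (i : ℕ) (x : L) :
    Algebra.trace K L (x ^ Fintype.card K ^ i) = Algebra.trace K L x := by
  have h := Algebra.trace_eq_of_algEquiv
    (FiniteField.frobeniusAlgEquivOfAlgebraic K L ^ i) x
  rwa [AlgEquiv.coe_pow, FiniteField.coe_frobeniusAlgEquivOfAlgebraic_iterate] at h

theorem pow_card_pow_surjective (i : ℕ) :
    Function.Surjective fun x : L ↦ x ^ Fintype.card K ^ i := by
  have h := (FiniteField.frobeniusAlgEquivOfAlgebraic K L ^ i).surjective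
  rwa [AlgEquiv.coe_pow, FiniteField.coe_frobeniusAlgEquivOfAlgebraic_iterate] at h

theorem mem_range_algebraMap_of_pow_card_eq {x : L} (hx : x ^ Fintype.card K = x) :
    ∃ t : K, algebraMap K L t = x := by
  have hfix : ∀ g : Gal(L/K), g x = x := by
    intro g
    obtain ⟨i, rfl⟩ := (FiniteField.bijective_frobeniusAlgEquivOfAlgebraic_pow K L).2 g
    simp only [AlgEquiv.coe_pow]
    exact Function.IsFixedPt.iterate (f := FiniteField.frobeniusAlgEquivOfAlgebraic K L) hx _
  exact IntermediateField.mem_bot.mp ((IsGalois.mem_bot_iff_fixed x).mpr hfix)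

/-- Additive Hilbert 90 for finite fields. -/
theorem exists_pow_card_sub_eq_iff (x : L) :
    (∃ y : L, y ^ Fintype.card K - y = x) ↔ Algebra.trace K L x = 0 := by
  let φ : L →ₗ[K] L := (FiniteField.frobeniusAlgHom K L).toLinearMap - LinearMap.id
  have hle : LinearMap.range φ ≤ LinearMap.ker (Algebra.trace K L) := by
    rintro _ ⟨y, rfl⟩
    have := trace_pow_card_pow (K := K) 1 y
    rw [pow_one] at this
    simp [φ, this]
  have hker : finrank K (LinearMap.ker φ) ≤ 1 := by
    refine finrank_le_one (⟨1, by simp [φ]⟩ : LinearMap.ker φ) ?_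
    rintro ⟨y, hy⟩
    obtain ⟨t, rfl⟩ := mem_range_algebraMap_of_pow_card_eq (K := K) (x := y)
      (by simpa [φ, sub_eq_zero] using hy)
    exact ⟨t, Subtype.ext (by simp [Algebra.smul_def])⟩
  have hsurj : LinearMap.range (Algebra.trace K L) = ⊤ :=
    LinearMap.range_eq_top.mpr (Algebra.trace_surjective K L)
  have h1 := φ.finrank_range_add_finrank_ker
  have h2 := (Algebra.trace K L).finrank_range_add_finrank_ker
  rw [hsurj, finrank_top, finrank_self] at h2
  have heq := Submodule.eq_of_le_of_finrank_le hle (by omega)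
  exact SetLike.ext_iff.mp heq x

theorem trace_eq_zero_of_pow_card_pow_eq_neg {r : ℕ}
    (heven : Even (finrank K L / (finrank K L).gcd r)) {w : L}
    (hw : w ^ Fintype.card K ^ r = -w) : Algebra.trace K L w = 0 := by
  have htr := trace_pow_card_pow (K := K) r w
  rw [hw, map_neg] at htr
  by_cases h2 : (2 : K) = 0
  · have h2L : (2 : L) = 0 := by
      rw [← map_ofNat (algebraMap K L) 2, h2, map_zero]
    have hneg : -w = w := by linear_combination -w * h2L
    rw [hneg] at hw
    let φ : L → L := fun x ↦ x ^ Fintype.card K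
    have hiter (i : ℕ) (x : L) : φ^[i] x = x ^ Fintype.card K ^ i := by
      simp only [φ, pow_iterate]
    have hr : Function.IsPeriodicPt φ r w := (hiter r w).trans hw
    have hd : Function.IsPeriodicPt φ (finrank K L) w := by
      refine (hiter _ w).trans ?_
      have := Fintype.ofFinite L
      rw [← Module.card_eq_pow_finrank, FiniteField.pow_card]
    have hu := hd.gcd hr
    obtain ⟨m, hm⟩ := heven
    have hd2 : finrank K L = (finrank K L).gcd r * m + (finrank K L).gcd r * m := by
      rw [← mul_add, ← hm, Nat.mul_div_cancel' (Nat.gcd_dvd_left _ _)]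
    have hs := hu.mul_const m
    generalize (finrank K L).gcd r * m = s at hd2 hs
    apply FaithfulSMul.algebraMap_injective K L
    rw [FiniteField.algebraMap_trace_eq_sum_pow, Nat.card_eq_fintype_card, hd2,
      Finset.sum_range_add, map_zero]
    have hshift (i : ℕ) : w ^ Fintype.card K ^ (s + i) = w ^ Fintype.card K ^ i := by
      rw [← hiter, ← hiter, add_comm, Function.iterate_add_apply, hs.eq]
    simp only [hshift]
    rw [← two_mul, h2L, zero_mul]
  · have : (2 : K) * Algebra.trace K L w = 0 := by linear_combination -htr
    exact (mul_eq_zero.mp this).resolve_left h2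

/-- The map `x ↦ a ^ (q ^ r) * x ^ (q ^ (2 * r)) + a * x` is, up to a twist, self-adjoint for the
trace form. -/
theorem trace_mul_pow_comm (r : ℕ) (a x z : L) :
    Algebra.trace K L ((a ^ Fintype.card K ^ r * x ^ Fintype.card K ^ (2 * r) + a * x) *
        z ^ Fintype.card K ^ r) =
      Algebra.trace K L (a * (x ^ Fintype.card K ^ r * z + x * z ^ Fintype.card K ^ r)) := by
  have h := trace_pow_card_pow (K := K) r (a * x ^ Fintype.card K ^ r * z)
  rw [mul_pow, mul_pow, ← pow_mul, ← pow_add, ← two_mul] at h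
  rw [add_mul, map_add, h, ← map_add]
  congr 1
  ring

theorem exists_ker_trace_mul_eq_one (r : ℕ) (a b : L)
    (hns : ¬∃ x : L, a ^ Fintype.card K ^ r * x ^ Fintype.card K ^ (2 * r) + a * x =
      -(b ^ Fintype.card K ^ r)) :
    ∃ z : L, a ^ Fintype.card K ^ r * z ^ Fintype.card K ^ (2 * r) + a * z = 0 ∧
      Algebra.trace K L (b * z) = 1 := by
  let f : L →ₗ[K] L :=
    LinearMap.mulLeft K (a ^ Fintype.card K ^ r) ∘ₗ
      (FiniteField.frobeniusAlgHom K L ^ (2 * r)).toLinearMap + LinearMap.mulLeft K a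
  have hf (x : L) : f x = a ^ Fintype.card K ^ r * x ^ Fintype.card K ^ (2 * r) + a * x := by
    simp [f, frobeniusAlgHom_pow_apply, -AlgHom.coe_pow]
  have hv : -(b ^ Fintype.card K ^ r) ∉ LinearMap.range f := by
    rintro ⟨x, hx⟩
    exact hns ⟨x, (hf x).symm.trans hx⟩
  obtain ⟨g, hgv, hg⟩ := Submodule.exists_le_ker_of_notMem hv
  have hnd := traceForm_nondegenerate K L
  obtain ⟨w, rfl⟩ := ((Algebra.traceForm K L).toDual hnd).surjective g
  obtain ⟨z, rfl⟩ := pow_card_pow_surjective (K := K) (L := L) r w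
  simp only [LinearMap.BilinForm.toDual_def, Algebra.traceForm_apply] at hgv
  have hz : f z = 0 := by
    apply hnd.1
    intro y
    obtain ⟨x, rfl⟩ := pow_card_pow_surjective (K := K) (L := L) r y
    have hx : Algebra.trace K L (z ^ Fintype.card K ^ r * f x) = 0 := hg ⟨x, rfl⟩
    rw [Algebra.traceForm_apply, hf, trace_mul_pow_comm, ← hx, mul_comm _ (f x), hf,
      trace_mul_pow_comm]
    congr 1
    ring
  have hbz : Algebra.trace K L (b * z) ≠ 0 := by
    intro h0
    apply hgv
    rw [mul_neg, map_neg, ← mul_pow, trace_pow_card_pow, mul_comm, h0, neg_zero]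
  refine ⟨(Algebra.trace K L (b * z))⁻¹ • z, ?_, ?_⟩
  · rw [← hf, map_smul, hz, smul_zero]
  · rw [mul_smul_comm, map_smul, smul_eq_mul, inv_mul_cancel₀ hbz]

theorem card_artinSchreier_of_no_solution (r : ℕ)
    (heven : Even (finrank K L / (finrank K L).gcd r)) (a b c : L)
    (hns : ¬∃ x : L, a ^ Fintype.card K ^ r * x ^ Fintype.card K ^ (2 * r) + a * x =
      -(b ^ Fintype.card K ^ r)) :
    Nat.card {xy : L × L // xy.2 ^ Fintype.card K - xy.2 =
      a * xy.1 ^ (Fintype.card K ^ r + 1) + b * xy.1 + c} = Nat.card L := by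
  obtain ⟨z, hz, hbz⟩ := exists_ker_trace_mul_eq_one (K := K) r a b hns
  let T := Algebra.trace K L
  let g : L → L := fun x ↦ a * x ^ (Fintype.card K ^ r + 1) + b * x + c
  have hself : T (a * z ^ (Fintype.card K ^ r + 1)) = 0 := by
    refine trace_eq_zero_of_pow_card_pow_eq_neg heven ?_
    rw [pow_succ, mul_pow, mul_pow, ← pow_mul z, ← pow_add (Fintype.card K), ← two_mul r]
    linear_combination z ^ Fintype.card K ^ r * hz
  have hcross (x : L) :
      T (a * (x ^ Fintype.card K ^ r * z + x * z ^ Fintype.card K ^ r)) = 0 := by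
    have h := trace_mul_pow_comm (K := K) r a z x
    rw [hz, zero_mul, map_zero] at h
    rw [h]
    exact congrArg T (by ring)
  have hT (x : L) (t : K) : T (g (x + t • z)) = T (g x) + t := by
    have hpow : (x + t • z) ^ Fintype.card K ^ r =
        x ^ Fintype.card K ^ r + t • z ^ Fintype.card K ^ r := by
      simp only [← frobeniusAlgHom_pow_apply, map_add, map_smul]
    have hexp : g (x + t • z) = g x +
        t • (a * (x ^ Fintype.card K ^ r * z + x * z ^ Fintype.card K ^ r)) +
        (t * t) • (a * z ^ (Fintype.card K ^ r + 1)) + t • (b * z) := by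
      simp only [g, pow_succ, hpow]
      simp only [Algebra.smul_def, map_mul]
      ring
    rw [hexp, map_add, map_add, map_add, map_smul, map_smul, map_smul, hcross, hself]
    change _ + _ + _ + t • Algebra.trace K L (b * z) = _
    rw [hbz]
    simp
  have hy (x : L) : ∃ y : L, T (g x) = 0 → y ^ Fintype.card K - y = g x := by
    by_cases hx : T (g x) = 0
    · obtain ⟨y, hy⟩ := (exists_pow_card_sub_eq_iff (K := K) (g x)).mpr hx
      exact ⟨y, fun _ ↦ hy⟩
    · exact ⟨0, fun h ↦ absurd h hx⟩
  choose y hy using hy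
  have hzero (x : L) : T (g (x - T (g x) • z)) = 0 := by
    rw [sub_eq_add_neg, ← neg_smul, hT, add_neg_cancel]
  have hfrob (u v : L) : (u + v) ^ Fintype.card K = u ^ Fintype.card K + v ^ Fintype.card K :=
    map_add (FiniteField.frobeniusAlgHom K L) u v
  have hfrobK (t : K) : algebraMap K L t ^ Fintype.card K = algebraMap K L t := by
    rw [← map_pow, FiniteField.pow_card]
  symm
  refine Nat.card_congr (Equiv.ofBijective (fun x ↦ ⟨(x - T (g x) • z,
    y (x - T (g x) • z) + algebraMap K L (T (g x))), ?_⟩) ⟨?_, ?_⟩)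
  · have h := hy _ (hzero x)
    simp only [hfrob, hfrobK]
    change _ = g _
    linear_combination h
  · intro x x' h
    obtain ⟨h1, h2⟩ := Prod.mk.inj (Subtype.mk.inj h)
    rw [h1] at h2
    have h3 := FaithfulSMul.algebraMap_injective K L (add_left_cancel h2)
    rw [h3] at h1
    exact sub_left_injective h1
  · rintro ⟨⟨x, v⟩, hxv⟩
    change v ^ Fintype.card K - v = g x at hxv
    have hx : T (g x) = 0 := (exists_pow_card_sub_eq_iff (K := K) (g x)).mp ⟨v, hxv⟩
    obtain ⟨t, ht⟩ := mem_range_algebraMap_of_pow_card_eq (K := K) (x := v - y x) (by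
      have h1 := hy x hx
      have h2 := hfrob (v - y x) (y x)
      rw [sub_add_cancel] at h2
      linear_combination hxv - h1 - h2)
    refine ⟨x + t • z, Subtype.ext ?_⟩
    have h3 : T (g (x + t • z)) = t := by rw [hT, hx, zero_add]
    simp only [h3, add_sub_cancel_right, ht, add_sub_cancel]

end FiniteFieldTrace

theorem exists_subfield_algebra (p n : ℕ) [Fact p.Prime] (hn : n ≠ 0) (ℓ : ℕ)
    (F : Type) [Field F] [Fintype F] (hF : Fintype.card F = (p ^ n) ^ ℓ) :
    ∃ (K : Type) (_ : Field K) (_ : Fintype K) (_ : Algebra K F),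
      Fintype.card K = p ^ n ∧ finrank K F = ℓ := by
  have hp : p.Prime := Fact.out
  have : CharP F p := charP_of_card_eq_prime_pow (f := n * ℓ) (by rw [hF, pow_mul])
  let : Algebra (ZMod p) F := ZMod.algebra F p
  have hcardF : finrank (ZMod p) F = n * ℓ := by
    apply Nat.pow_right_injective hp.two_le
    have := Module.card_eq_pow_finrank (K := ZMod p) (V := F)
    rw [ZMod.card] at this
    simp only [← this, hF, pow_mul]
  obtain ⟨φ⟩ := FiniteField.nonempty_algHom_of_finrank_dvd (F := ZMod p)
    (K := GaloisField p n) (L := F) (by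
      rw [GaloisField.finrank p hn, hcardF]; exact dvd_mul_right _ _)
  let : Fintype (GaloisField p n) := Fintype.ofFinite _
  let : Algebra (GaloisField p n) F := φ.toRingHom.toAlgebra
  have hcard : Fintype.card (GaloisField p n) = p ^ n := by
    rw [← Nat.card_eq_fintype_card, GaloisField.card p n hn]
  refine ⟨GaloisField p n, inferInstance, inferInstance, inferInstance, hcard, ?_⟩
  have h := Module.card_eq_pow_finrank (K := GaloisField p n) (V := F)
  rw [hF, hcard] at h
  exact (Nat.pow_right_injective (hp.two_le.trans (Nat.le_self_pow hn p)) h).symm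

/-- Let `p` be prime, `q = p ^ n`, and `ℓ ≥ 2`, `r ≥ 1` with `ℓ / u` even,
`u = gcd(ℓ, r)`.  Let `a, b, c ∈ F_{q^ℓ}` with `a ≠ 0` and `f(x) = a^(q^r) x^(q^(2r)) + a x`.
If `f(x) = -b^(q^r)` has no solution in `F_{q^ℓ}`, then `N_{ℓ,r}(a,b,c) = q ^ ℓ`. -/
theorem stmt_8 (p n : ℕ) (hp : p.Prime) (hn : 1 ≤ n) (q : ℕ) (hq : q = p ^ n)
    (ℓ r : ℕ) (hℓ : 2 ≤ ℓ) (hr : 1 ≤ r)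
    (u : ℕ) (hu : u = Nat.gcd ℓ r) (heven : Even (ℓ / u))
    (F : Type) [Field F] [Fintype F] (hF : Fintype.card F = q ^ ℓ)
    (a b c : F) (ha : a ≠ 0)
    (hns : ¬∃ x : F, a ^ q ^ r * x ^ q ^ (2 * r) + a * x = -(b ^ q ^ r)) :
    Nat.card {xy : F × F // xy.2 ^ q - xy.2 = a * xy.1 ^ (q ^ r + 1) + b * xy.1 + c}
      = q ^ ℓ := by
  subst hq hu
  have := Fact.mk hp
  obtain ⟨K, _, _, _, hK, hd⟩ := exists_subfield_algebra p n (by omega) ℓ F hF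
  rw [← hK] at hns ⊢
  rw [← hd] at heven
  rw [card_artinSchreier_of_no_solution r heven a b c hns, Nat.card_eq_fintype_card, hF, hK]
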